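/- Let f : [0,1] → [0,1] be a trade-off function (convex, nonincreasing, with f(x) ≤ 1 − x for all x). Let (B, B̂) be {0,1}-valued random variables with P(B = 0) = P(B = 1) = 1/2, P(B̂ = 1 | B = 0) = α, P(B̂ = 0 | B = 1) = β, and suppose β ≥ f(α) and α + β ≤ 1. Let p^e = P(B̂ ≠ B) = (α + β)/2 and assume p^e ≤ 1/2. Then h(p^e) ≥ 1 − u_f(1/2); equivalently, p^e ≥ h^{-1}(1 − u_f(1/2)), where h^{-1} : [0,1] → [0,1/2] is the inverse of the restriction of h to [0,1/2], and u_f(1/2) = sup_{x ∈ [0,1]} [ h((f(x) + 1 − x)/2) − (h(f(x)) + h(1−x))/2 ]. -/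

import Mathlib

open MeasureTheory
open scoped ENNReal

/-- Binary entropy function (base 2), with the convention `h 0 = h 1 = 0`. -/
noncomputable def binH (x : ℝ) : ℝ :=
  -(x * Real.logb 2 x) - (1 - x) * Real.logb 2 (1 - x)

/-- `u_f(1/2) = sup_{x ∈ [0,1]} [ h((f(x) + 1 − x)/2) − (h(f(x)) + h(1−x))/2 ]`. -/
noncomputable def ufHalf (f : ℝ → ℝ) : ℝ :=
  sSup ((fun x => binH ((f x + 1 - x) / 2) - (binH (f x) + binH (1 - x)) / 2) ''
    Set.Icc (0:ℝ) 1)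

theorem binH_eq_binEntropy_div (x : ℝ) : binH x = Real.binEntropy x / Real.log 2 := by
  rw [Real.binEntropy_eq_negMulLog_add_negMulLog_one_sub]
  simp only [binH, Real.logb, Real.negMulLog]
  ring

/-- The term of Gibbs' inequality for the mass `p / 2` against the product mass `s * t`. -/
theorem mul_log_half_gibbs {p s t : ℝ} (hp : 0 ≤ p) (hs : p / 2 ≤ s) (ht : p / 2 ≤ t) :
    p * (Real.log s + Real.log t + Real.log 2 - Real.log p) ≤ 2 * (s * t) - p := by
  rcases hp.eq_or_lt with rfl | hp
  · have hs' : 0 ≤ s := by linarith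
    have ht' : 0 ≤ t := by linarith
    have := mul_nonneg hs' ht'
    linarith
  · have hs' : 0 < s := by linarith
    have ht' : 0 < t := by linarith
    have hlog : Real.log s + Real.log t + Real.log 2 - Real.log p =
        Real.log (s * t * 2 / p) := by
      rw [Real.log_div (by positivity) hp.ne', Real.log_mul (by positivity) two_ne_zero,
        Real.log_mul hs'.ne' ht'.ne']
    calc p * (Real.log s + Real.log t + Real.log 2 - Real.log p)
        ≤ p * (s * t * 2 / p - 1) := by
          rw [hlog]
          exact mul_le_mul_of_nonneg_left (Real.log_le_sub_one_of_pos (by positivity)) hp.le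
      _ = 2 * (s * t) - p := by field_simp

/-- Fano's inequality for a uniform bit sent through a binary channel with error rates
`a` and `b`. -/
theorem binEntropy_fano {a b : ℝ} (ha0 : 0 ≤ a) (ha1 : a ≤ 1) (hb0 : 0 ≤ b) (hb1 : b ≤ 1) :
    Real.log 2 + (Real.binEntropy a + Real.binEntropy b) / 2 ≤
      Real.binEntropy ((b + 1 - a) / 2) + Real.binEntropy ((a + b) / 2) := by
  have h00 := mul_log_half_gibbs (p := 1 - a) (s := (b + 1 - a) / 2) (t := 1 - (a + b) / 2)
    (by linarith) (by linarith) (by linarith)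
  have h11 := mul_log_half_gibbs (p := a) (s := 1 - (b + 1 - a) / 2) (t := (a + b) / 2)
    (by linarith) (by linarith) (by linarith)
  have h01 := mul_log_half_gibbs (p := b) (s := (b + 1 - a) / 2) (t := (a + b) / 2)
    (by linarith) (by linarith) (by linarith)
  have h10 := mul_log_half_gibbs (p := 1 - b) (s := 1 - (b + 1 - a) / 2)
    (t := 1 - (a + b) / 2) (by linarith) (by linarith) (by linarith)
  simp only [Real.binEntropy_eq_negMulLog_add_negMulLog_one_sub, Real.negMulLog]
  linarith

theorem bddAbove_ufHalf_image {f : ℝ → ℝ} (hf : ∀ x ∈ Set.Icc (0 : ℝ) 1, f x ∈ Set.Icc (0 : ℝ) 1) :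
    BddAbove ((fun x => binH ((f x + 1 - x) / 2) - (binH (f x) + binH (1 - x)) / 2) ''
      Set.Icc (0 : ℝ) 1) := by
  refine ⟨1, ?_⟩
  rintro _ ⟨x, hx, rfl⟩
  have hlog : 0 < Real.log 2 := Real.log_pos one_lt_two
  simp only [binH_eq_binEntropy_div]
  have h1 : Real.binEntropy ((f x + 1 - x) / 2) / Real.log 2 ≤ 1 :=
    (div_le_one hlog).2 Real.binEntropy_le_log_two
  have h2 := div_nonneg (Real.binEntropy_nonneg (hf x hx).1 (hf x hx).2) hlog.le
  have h3 : 0 ≤ Real.binEntropy (1 - x) / Real.log 2 :=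
    div_nonneg (Real.binEntropy_nonneg (by linarith [hx.2]) (by linarith [hx.1])) hlog.le
  linarith

/-- Bit error lower bound: with uniform input bit and error rates respecting the
trade-off function `f`, the error probability `p^e = (α+β)/2 ≤ 1/2` satisfies
`h(p^e) ≥ 1 − u_f(1/2)` (equivalently `p^e ≥ h⁻¹(1 − u_f(1/2))`). -/
theorem bit_error_lower_bound {Ω : Type*} [MeasurableSpace Ω] (P : Measure Ω)
    [IsProbabilityMeasure P]
    (f : ℝ → ℝ) (hf_conv : ConvexOn ℝ (Set.Icc (0:ℝ) 1) f)
    (hf_anti : AntitoneOn f (Set.Icc (0:ℝ) 1))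
    (hf_mem : ∀ x ∈ Set.Icc (0:ℝ) 1, f x ∈ Set.Icc (0:ℝ) 1)
    (hf_le : ∀ x ∈ Set.Icc (0:ℝ) 1, f x ≤ 1 - x)
    (B Bhat : Ω → Bool) (hB : Measurable B) (hBhat : Measurable Bhat)
    (α β : ℝ)
    (hB0 : (P (B ⁻¹' {false})).toReal = 1 / 2)
    (hB1 : (P (B ⁻¹' {true})).toReal = 1 / 2)
    (hα : (P (Bhat ⁻¹' {true} ∩ B ⁻¹' {false})).toReal = α * (1 / 2))
    (hβ : (P (Bhat ⁻¹' {false} ∩ B ⁻¹' {true})).toReal = β * (1 / 2))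
    (htradeoff : f α ≤ β) (hsum : α + β ≤ 1)
    (pe : ℝ) (hpe : pe = (P {ω | Bhat ω ≠ B ω}).toReal) (hpe_eq : pe = (α + β) / 2)
    (hpe_le : pe ≤ 1 / 2) :
    1 - ufHalf f ≤ binH pe := by
  have hα0 : 0 ≤ α := by
    have := ENNReal.toReal_nonneg (a := P (Bhat ⁻¹' {true} ∩ B ⁻¹' {false}))
    linarith
  have hα1 : α ≤ 1 := by
    have := ENNReal.toReal_mono (measure_ne_top P _)
      (measure_mono (Set.inter_subset_right : Bhat ⁻¹' {true} ∩ B ⁻¹' {false} ⊆ B ⁻¹' {false}))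
    linarith
  have hαmem : α ∈ Set.Icc (0 : ℝ) 1 := ⟨hα0, hα1⟩
  obtain ⟨hf0, hf1⟩ := hf_mem α hαmem
  have hlog : 0 < Real.log 2 := Real.log_pos one_lt_two
  have hsup := le_csSup (bddAbove_ufHalf_image hf_mem) (Set.mem_image_of_mem _ hαmem)
  change _ ≤ ufHalf f at hsup
  simp only [binH_eq_binEntropy_div, Real.binEntropy_one_sub] at hsup ⊢
  have hmono : Real.binEntropy ((α + f α) / 2) ≤ Real.binEntropy pe :=
    Real.binEntropy_strictMonoOn.monotoneOn ⟨by linarith, by linarith⟩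
      ⟨by linarith, by linarith⟩ (by linarith)
  have hfano : 1 ≤ (Real.binEntropy ((f α + 1 - α) / 2) + Real.binEntropy pe -
      (Real.binEntropy α + Real.binEntropy (f α)) / 2) / Real.log 2 := by
    rw [one_le_div hlog]
    linarith [binEntropy_fano hα0 hα1 hf0 hf1]
  have hsplit : (Real.binEntropy ((f α + 1 - α) / 2) + Real.binEntropy pe -
      (Real.binEntropy α + Real.binEntropy (f α)) / 2) / Real.log 2 =
      (Real.binEntropy ((f α + 1 - α) / 2) / Real.log 2 - (Real.binEntropy (f α) / Real.log 2 +
        Real.binEntropy α / Real.log 2) / 2) + Real.binEntropy pe / Real.log 2 := by ring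
  linarith
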